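/- Let G be a finitely generated group such that every group homomorphism from G to every finite group is trivial. Then for every natural number n, every group homomorphism ρ : G → GL(n, ℂ) is trivial, i.e., ρ(g) = 1 for all g ∈ G. -/

import Mathlib

theorem aux_int_jacobson : IsJacobsonRing ℤ := by
  rw [isJacobsonRing_iff_prime_eq]
  intro P hP
  by_cases hb : P = ⊥
  · subst hb
    rw [eq_bot_iff]
    intro x hx
    have h1 := Ideal.mem_jacobson_bot.mp hx x
    rw [Int.isUnit_iff] at h1
    rw [Ideal.mem_bot]
    rcases h1 with h1 | h1 <;> nlinarith
  · have : P.IsMaximal := hP.isMaximal hb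
    exact Ideal.jacobson_eq_self_of_isMaximal

theorem aux_finite_field (K : Type) [Field K] [inst : Algebra ℤ K]
    [Algebra.FiniteType ℤ K] : Finite K := by
  obtain rfl : inst = Ring.toIntAlgebra K := Subsingleton.elim _ _
  have := aux_int_jacobson
  have hfin : Module.Finite ℤ K := finite_of_finite_type_of_isJacobsonRing ℤ K
  have hni : ¬ Function.Injective (algebraMap ℤ K) := by
    intro hinj
    exact Int.not_isField (isField_of_isIntegral_of_isField hinj (Field.toIsField K))
  rw [injective_iff_map_eq_zero] at hni
  push Not at hni
  obtain ⟨a, ha, ha0⟩ := hni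
  refine Module.finite_of_fg_torsion K ?_
  intro x
  refine ⟨⟨a, mem_nonZeroDivisors_of_ne_zero ha0⟩, ?_⟩
  change a • x = 0
  rw [Algebra.smul_def, ha, zero_mul]

/-- If `G` is a finitely generated group all of whose homomorphisms to finite
groups are trivial, then every complex linear representation `ρ : G → GL(n, ℂ)`
is trivial. -/
theorem stmt5 (G : Type) [Group G] [Group.FG G]
    (h : ∀ (H : Type) (_ : Group H), Finite H → ∀ φ : G →* H, ∀ g : G, φ g = 1)
    (n : ℕ) (ρ : G →* Matrix.GeneralLinearGroup (Fin n) ℂ) (g : G) :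
    ρ g = 1 := by
  have hM : Monoid.FG G := Group.fg_iff_monoid_fg.mp inferInstance
  obtain ⟨S, hS, hSfin⟩ := Monoid.fg_iff.mp hM
  let T : Set ℂ := ⋃ s ∈ S, Set.range (fun p : Fin n × Fin n => (ρ s).1 p.1 p.2)
  have hT : T.Finite := hSfin.biUnion fun s _ => Set.finite_range _
  let A := Algebra.adjoin ℤ T
  have hA : Algebra.FiniteType ℤ A := .adjoin_of_finite hT
  have hmem : ∀ g : G, ∀ i j, (ρ g).1 i j ∈ A := by
    intro g
    have hg : g ∈ Submonoid.closure S := by rw [hS]; trivial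
    induction hg using Submonoid.closure_induction with
    | mem s hs =>
      intro i j
      exact Algebra.subset_adjoin (Set.mem_biUnion hs ⟨(i, j), rfl⟩)
    | one =>
      intro i j
      rw [map_one, Units.val_one, Matrix.one_apply]
      split_ifs
      · exact one_mem _
      · exact zero_mem _
    | mul x y _ _ hx hy =>
      intro i j
      rw [map_mul, Units.val_mul, Matrix.mul_apply]
      exact sum_mem fun k _ => mul_mem (hx i k) (hy k j)
  let ψ : G →* Matrix (Fin n) (Fin n) A :=
    { toFun := fun g => Matrix.of fun i j => ⟨(ρ g).1 i j, hmem g i j⟩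
      map_one' := by
        ext i j
        simp [Matrix.one_apply]
        split_ifs <;> rfl
      map_mul' := by
        intro x y
        ext i j
        simp [Matrix.mul_apply] }
  have := aux_int_jacobson
  have hJ : IsJacobsonRing A := isJacobsonRing_of_finiteType (A := ℤ)
  have key : ψ g = 1 := by
    ext1 i j
    rw [← sub_eq_zero, ← Ideal.mem_bot,
      ← hJ.out (I := (⊥ : Ideal A)) Ideal.isPrime_bot.isRadical, Ideal.jacobson, Ideal.mem_sInf]
    rintro m ⟨-, hm⟩
    let _ := Ideal.Quotient.field m
    have hft : Algebra.FiniteType ℤ (A ⧸ m) :=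
      Algebra.FiniteType.of_surjective (Ideal.Quotient.mkₐ ℤ m) (Ideal.Quotient.mkₐ_surjective ℤ m)
    have hfin : Finite (A ⧸ m) := aux_finite_field (A ⧸ m)
    let Φ : Matrix (Fin n) (Fin n) A →* Matrix (Fin n) (Fin n) (A ⧸ m) :=
      ((Ideal.Quotient.mk m).mapMatrix : Matrix (Fin n) (Fin n) A →+* _)
    have hmat : Finite (Matrix (Fin n) (Fin n) (A ⧸ m)) :=
      inferInstanceAs (Finite (Fin n → Fin n → A ⧸ m))
    have hgl : Finite (Matrix.GeneralLinearGroup (Fin n) (A ⧸ m)) :=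
      Finite.of_injective _ Units.val_injective
    have hu := h (Matrix.GeneralLinearGroup (Fin n) (A ⧸ m)) Units.instGroup hgl
      (MonoidHom.toHomUnits (Φ.comp ψ)) g
    have h1 := congrArg Units.val hu
    have h2 := congrFun (congrFun h1 i) j
    rw [← Ideal.Quotient.eq_zero_iff_mem, map_sub, sub_eq_zero]
    refine Eq.trans h2 ?_
    rw [Units.val_one, Matrix.one_apply, Matrix.one_apply]
    split_ifs <;> simp
  ext i j
  have h3 := congrArg Subtype.val (congrFun (congrFun key i) j)
  refine Eq.trans h3 ?_
  rw [Units.val_one, Matrix.one_apply, Matrix.one_apply]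
  split_ifs <;> rfl
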